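/- Let (C₀,…,C_ℓ) be a chain and suppose that for some index i the set C_i has a chain certificate (C′₀,…,C′_{ℓ′}) (i.e. C_i = C′₀ ∪ ⋯ ∪ C′_{ℓ′} and (C′₀,…,C′_{ℓ′}) is a chain). Then (C′₀,…,C′_{ℓ′}) is a maximal chain. -/

import Mathlib

open Finset

variable {V : Type*} [Fintype V] [DecidableEq V]

/-- `cutW w X Y` is `C(X,Y) = Σ_{x∈X} Σ_{y∈Y} w(x,y)`. -/
def cutW (w : V → V → ℝ) (X Y : Finset V) : ℝ := ∑ x ∈ X, ∑ y ∈ Y, w x y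

/-- `C(X) := C(X, V ∖ X)`. -/
def cutVal (w : V → V → ℝ) (X : Finset V) : ℝ := cutW w X Xᶜ

/-- A cut is a nonempty proper subset of `V`. -/
def IsCut (X : Finset V) : Prop := X.Nonempty ∧ X ≠ Finset.univ

/-- A mincut is a cut of minimum weight. -/
def IsMincut (w : V → V → ℝ) (X : Finset V) : Prop :=
  IsCut X ∧ ∀ Y : Finset V, IsCut Y → cutVal w X ≤ cutVal w Y

/-- `X` and `Y` cross if `X∩Y`, `X∖Y`, `Y∖X` and `V∖(X∪Y)` are all nonempty. -/
def Crosses (X Y : Finset V) : Prop :=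
  (X ∩ Y).Nonempty ∧ (X \ Y).Nonempty ∧ (Y \ X).Nonempty ∧ ((X ∪ Y)ᶜ).Nonempty

/-- A minimal mincut of a vertex `v`: a mincut containing `v` but not the root `r`,
of minimum cardinality among all such mincuts. -/
def IsMinimalMincutOfVertex (w : V → V → ℝ) (r v : V) (X : Finset V) : Prop :=
  IsMincut w X ∧ v ∈ X ∧ r ∉ X ∧
    ∀ Y : Finset V, IsMincut w Y → v ∈ Y → r ∉ Y → X.card ≤ Y.card

/-- An edge is an unordered pair of distinct vertices with positive weight. -/
def IsEdge (w : V → V → ℝ) (u₁ u₂ : V) : Prop := u₁ ≠ u₂ ∧ 0 < w u₁ u₂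

/-- A minimal mincut of an edge `{u₁,u₂}`: a mincut containing both endpoints but not the
root `r`, of minimum cardinality among all such mincuts. -/
def IsMinimalMincutOfEdge (w : V → V → ℝ) (r u₁ u₂ : V) (X : Finset V) : Prop :=
  IsEdge w u₁ u₂ ∧ IsMincut w X ∧ u₁ ∈ X ∧ u₂ ∈ X ∧ r ∉ X ∧
    ∀ Y : Finset V, IsMincut w Y → u₁ ∈ Y → u₂ ∈ Y → r ∉ Y → X.card ≤ Y.card

/-- Union of the members of a chain. -/
def chainUnion (C : List (Finset V)) : Finset V := C.foldr (· ∪ ·) ∅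

/-- `X ⊆ V∖{r}` has a certificate if it is the minimal mincut of some vertex,
the minimal mincut of some edge, or the union of a chain, where a chain is a sequence
`(C₀,…,C_ℓ)` (`ℓ ≥ 1`) of pairwise disjoint nonempty subsets of `V∖{r}` such that every
`C_i` has a certificate and each `C_i ∪ C_{i+1}` is the minimal mincut of some edge. -/
inductive HasCert (w : V → V → ℝ) (r : V) : Finset V → Prop
  | vertex {v : V} {X : Finset V} : IsMinimalMincutOfVertex w r v X → HasCert w r X
  | edge {u₁ u₂ : V} {X : Finset V} : IsMinimalMincutOfEdge w r u₁ u₂ X → HasCert w r X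
  | chain {C : List (Finset V)} :
      2 ≤ C.length →
      (∀ A ∈ C, A.Nonempty) →
      (∀ A ∈ C, r ∉ A) →
      C.Pairwise (fun A B => Disjoint A B) →
      (∀ A ∈ C, HasCert w r A) →
      (∀ i (h : i + 1 < C.length),
        ∃ u₁ u₂, IsMinimalMincutOfEdge w r u₁ u₂
          (C.get ⟨i, Nat.lt_of_succ_lt h⟩ ∪ C.get ⟨i + 1, h⟩)) →
      HasCert w r (chainUnion C)

/-- `(C₀,…,C_ℓ)` with `ℓ ≥ 1` is a chain. -/
def IsMincutChain (w : V → V → ℝ) (r : V) (C : List (Finset V)) : Prop :=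
  2 ≤ C.length ∧
  (∀ A ∈ C, A.Nonempty) ∧
  (∀ A ∈ C, r ∉ A) ∧
  C.Pairwise (fun A B => Disjoint A B) ∧
  (∀ A ∈ C, HasCert w r A) ∧
  (∀ i (h : i + 1 < C.length),
    ∃ u₁ u₂, IsMinimalMincutOfEdge w r u₁ u₂
      (C.get ⟨i, Nat.lt_of_succ_lt h⟩ ∪ C.get ⟨i + 1, h⟩))

/-- A subchain is a consecutive subsequence of a chain or of its reversal. -/
def IsSubchain (D C : List (Finset V)) : Prop := D <:+: C ∨ D <:+: C.reverse

/-- A maximal chain is a chain that is not a subchain of any strictly longer chain. -/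
def IsMaximalMincutChain (w : V → V → ℝ) (r : V) (C : List (Finset V)) : Prop :=
  IsMincutChain w r C ∧
    ¬ ∃ D : List (Finset V), IsMincutChain w r D ∧ C.length < D.length ∧ IsSubchain C D

/-- `lam` is the minimum weight of a cut. -/
def IsMincutValue (w : V → V → ℝ) (lam : ℝ) : Prop :=
  (∃ X : Finset V, IsCut X ∧ cutVal w X = lam) ∧
  ∀ X : Finset V, IsCut X → lam ≤ cutVal w X

section Helpers

lemma cutW_union_left' (w : V → V → ℝ) {A B : Finset V} (Y : Finset V) (h : Disjoint A B) :
    cutW w (A ∪ B) Y = cutW w A Y + cutW w B Y := by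
  unfold cutW; rw [Finset.sum_union h]

lemma cutW_comm' (w : V → V → ℝ) (hsym : ∀ x y, w x y = w y x) (A B : Finset V) :
    cutW w A B = cutW w B A := by
  unfold cutW; rw [Finset.sum_comm]
  exact Finset.sum_congr rfl fun x _ => Finset.sum_congr rfl fun y _ => hsym _ _

lemma cutW_union_right' (w : V → V → ℝ) {A B : Finset V} (Y : Finset V) (h : Disjoint A B) :
    cutW w Y (A ∪ B) = cutW w Y A + cutW w Y B := by
  unfold cutW; rw [← Finset.sum_add_distrib]
  exact Finset.sum_congr rfl fun x _ => Finset.sum_union h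

lemma cutW_nonneg' (w : V → V → ℝ) (h0 : ∀ x y, 0 ≤ w x y) (A B : Finset V) :
    0 ≤ cutW w A B :=
  Finset.sum_nonneg fun _ _ => Finset.sum_nonneg fun _ _ => h0 _ _

lemma cutW_pos' (w : V → V → ℝ) (h0 : ∀ x y, 0 ≤ w x y) {A B : Finset V} {u v : V}
    (hu : u ∈ A) (hv : v ∈ B) (h : 0 < w u v) : 0 < cutW w A B := by
  have h1 : ∑ y ∈ B, w u y ≤ cutW w A B :=
    Finset.single_le_sum (f := fun x => ∑ y ∈ B, w x y)
      (fun _ _ => Finset.sum_nonneg fun _ _ => h0 _ _) hu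
  have h2 : w u v ≤ ∑ y ∈ B, w u y :=
    Finset.single_le_sum (f := fun y => w u y) (fun _ _ => h0 _ _) hv
  linarith

lemma cutVal_split (w : V → V → ℝ) {A B : Finset V} (h : Disjoint A B) :
    cutVal w A = cutW w A B + cutW w A (A ∪ B)ᶜ := by
  unfold cutVal
  rw [← cutW_union_right']
  · congr 1
    ext x
    have := fun hx => Finset.disjoint_left.1 h (show x ∈ _ from hx)
    simp only [mem_compl, mem_union]; tauto
  · rw [Finset.disjoint_left]; intro x; simp only [mem_compl, mem_union]; tauto

lemma cutVal_union (w : V → V → ℝ) (hsym : ∀ x y, w x y = w y x) {A B : Finset V}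
    (h : Disjoint A B) :
    cutVal w (A ∪ B) = cutVal w A + cutVal w B - 2 * cutW w A B := by
  rw [cutVal_split w h, cutVal_split w h.symm, cutW_comm' w hsym B A, Finset.union_comm B A]
  unfold cutVal
  rw [cutW_union_left' w _ h]; ring

lemma cutVal_two (w : V → V → ℝ) (h0 : ∀ x y, 0 ≤ w x y) {A B D : Finset V}
    (hAB : Disjoint A B) (hAD : Disjoint A D) (hBD : Disjoint B D) :
    cutW w A B + cutW w A D ≤ cutVal w A := by
  rw [← cutW_union_right' w A hBD, cutVal_split w (Finset.disjoint_union_right.2 ⟨hAB, hAD⟩)]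
  have := cutW_nonneg' w h0 A (A ∪ (B ∪ D))ᶜ
  linarith

lemma cutVal_eq_ind (w : V → V → ℝ) (X : Finset V) :
    cutVal w X = ∑ x, ∑ y, if x ∈ X ∧ y ∉ X then w x y else 0 := by
  unfold cutVal cutW
  rw [← Finset.sum_subset (Finset.subset_univ X)]
  · refine Finset.sum_congr rfl fun x hx => ?_
    rw [← Finset.sum_subset (Finset.subset_univ Xᶜ)]
    · refine Finset.sum_congr rfl fun y hy => ?_
      rw [if_pos ⟨hx, Finset.mem_compl.1 hy⟩]
    · intro y _ hy
      rw [if_neg]; simp at hy; tauto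
  · intro x _ hx
    exact Finset.sum_eq_zero fun y _ => if_neg (by tauto)

lemma cutVal_submod (w : V → V → ℝ) (h0 : ∀ x y, 0 ≤ w x y) (X Y : Finset V) :
    cutVal w (X ∩ Y) + cutVal w (X ∪ Y) ≤ cutVal w X + cutVal w Y := by
  simp only [cutVal_eq_ind, ← Finset.sum_add_distrib]
  refine Finset.sum_le_sum fun x _ => Finset.sum_le_sum fun y _ => ?_
  have := h0 x y
  by_cases a : x ∈ X <;> by_cases b : y ∈ X <;> by_cases c : x ∈ Y <;> by_cases d : y ∈ Y <;>
    simp [a, b, c, d, this]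

lemma mincut_eq {w : V → V → ℝ} {X Y : Finset V} (hX : IsMincut w X) (hY : IsMincut w Y) :
    cutVal w X = cutVal w Y := le_antisymm (hX.2 _ hY.1) (hY.2 _ hX.1)

lemma isCut_of {r : V} {X : Finset V} (hn : X.Nonempty) (hr : r ∉ X) : IsCut X :=
  ⟨hn, fun h => hr (h ▸ Finset.mem_univ r)⟩

lemma mincut_of_le {w : V → V → ℝ} {X Y : Finset V} (hX : IsMincut w X) (hY : IsCut Y)
    (h : cutVal w Y ≤ cutVal w X) : IsMincut w Y :=
  ⟨hY, fun Z hZ => h.trans (hX.2 Z hZ)⟩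

lemma mincut_inter_union {w : V → V → ℝ} (h0 : ∀ x y, 0 ≤ w x y) {r : V} {X Y : Finset V}
    (hX : IsMincut w X) (hY : IsMincut w Y) (hrX : r ∉ X) (hrY : r ∉ Y)
    (hn : (X ∩ Y).Nonempty) : IsMincut w (X ∩ Y) ∧ IsMincut w (X ∪ Y) := by
  have h1 : IsCut (X ∩ Y) := isCut_of (r := r) hn (by simp [hrX])
  have h2 : IsCut (X ∪ Y) := isCut_of (r := r) (hX.1.1.mono Finset.subset_union_left)
    (by simp [hrX, hrY])
  have := cutVal_submod w h0 X Y
  have a := hX.2 _ h1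
  have b := hX.2 _ h2
  have c := mincut_eq hX hY
  exact ⟨mincut_of_le hX h1 (by linarith), mincut_of_le hX h2 (by linarith)⟩

lemma mincut_half {w : V → V → ℝ} (hsym : ∀ x y, w x y = w y x) {A B : Finset V}
    (hA : IsMincut w A) (hB : IsMincut w B) (hAB : IsMincut w (A ∪ B)) (hd : Disjoint A B) :
    2 * cutW w A B = cutVal w A := by
  have := cutVal_union w hsym hd
  have := mincut_eq hA hB
  have := mincut_eq hA hAB
  linarith

/-- The part of the chain structure used in the argument. -/
def WeakChain (w : V → V → ℝ) (r : V) (C : List (Finset V)) : Prop :=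
  (∀ A ∈ C, IsMincut w A ∧ r ∉ A) ∧ C.Pairwise (fun A B => Disjoint A B) ∧
    C.IsChain (fun A B => IsMincut w (A ∪ B))

lemma WeakChain.reverse {w : V → V → ℝ} {r : V} {C : List (Finset V)} (h : WeakChain w r C) :
    WeakChain w r C.reverse := by
  refine ⟨fun A hA => h.1 A (List.mem_reverse.1 hA), ?_, ?_⟩
  · rw [List.pairwise_reverse]; exact h.2.1.imp fun h => h.symm
  · rw [List.isChain_reverse]; exact h.2.2.imp fun A B h => by rwa [Finset.union_comm] at h

lemma WeakChain.infix {w : V → V → ℝ} {r : V} {C D : List (Finset V)} (h : WeakChain w r C)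
    (hD : D <:+: C) : WeakChain w r D :=
  ⟨fun A hA => h.1 A (hD.subset hA), h.2.1.sublist hD.sublist, h.2.2.infix hD⟩

lemma mem_chainUnion {C : List (Finset V)} {x : V} : x ∈ chainUnion C ↔ ∃ A ∈ C, x ∈ A := by
  induction C with
  | nil => simp [chainUnion]
  | cons A L ih =>
    have : chainUnion (A :: L) = A ∪ chainUnion L := rfl
    rw [this, Finset.mem_union, ih]; simp

lemma WeakChain.union_mincut {w : V → V → ℝ} (h0 : ∀ x y, 0 ≤ w x y) {r : V} :
    ∀ {C : List (Finset V)}, C ≠ [] → WeakChain w r C → IsMincut w (chainUnion C)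
  | [], h, _ => absurd rfl h
  | [A], _, h => by
    have : chainUnion [A] = A := by simp [chainUnion]
    rw [this]; exact (h.1 A (by simp)).1
  | A :: B :: L, _, h => by
    have hR : IsMincut w (chainUnion (B :: L)) :=
      WeakChain.union_mincut h0 (by simp) (h.infix (List.suffix_cons A _).isInfix)
    have hAB : IsMincut w (A ∪ B) := (List.isChain_cons_cons.1 h.2.2).1
    have hrA := (h.1 A (by simp)).2
    have hrB := (h.1 B (by simp)).2
    have hBn := (h.1 B (by simp)).1.1.1
    have hrR : r ∉ chainUnion (B :: L) := by
      rw [mem_chainUnion]; rintro ⟨D, hD, hr⟩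
      exact (h.1 D (List.mem_cons_of_mem _ hD)).2 hr
    have hU : chainUnion (A :: B :: L) = (A ∪ B) ∪ chainUnion (B :: L) := by
      ext x; simp only [mem_union, mem_chainUnion, List.mem_cons]; grind
    rw [hU]
    refine (mincut_inter_union h0 hAB hR (by simp [hrA, hrB]) hrR ?_).2
    obtain ⟨x, hx⟩ := hBn
    refine ⟨x, ?_⟩
    simp only [mem_inter, mem_union, mem_chainUnion]
    exact ⟨Or.inr hx, B, by simp, hx⟩

lemma weakChain_of {w : V → V → ℝ} {r : V} {C : List (Finset V)}
    (h1 : ∀ A ∈ C, IsMincut w A ∧ r ∉ A) (h2 : C.Pairwise (fun A B => Disjoint A B))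
    (h3 : ∀ i (h : i + 1 < C.length),
      ∃ u₁ u₂, IsMinimalMincutOfEdge w r u₁ u₂
        (C.get ⟨i, Nat.lt_of_succ_lt h⟩ ∪ C.get ⟨i + 1, h⟩)) : WeakChain w r C := by
  refine ⟨h1, h2, ?_⟩
  rw [List.isChain_iff_getElem]
  intro i h
  obtain ⟨_, _, h⟩ := h3 i h
  exact h.2.1

lemma HasCert.mincut {w : V → V → ℝ} (h0 : ∀ x y, 0 ≤ w x y) {r : V} {X : Finset V}
    (h : HasCert w r X) : IsMincut w X ∧ r ∉ X := by
  induction h with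
  | vertex h => exact ⟨h.1, h.2.2.1⟩
  | edge h => exact ⟨h.2.1, h.2.2.2.2.1⟩
  | @chain C hl _ hr hd _ he ih =>
    refine ⟨(weakChain_of ih hd he).union_mincut h0 (by rintro rfl; simp at hl), ?_⟩
    rw [mem_chainUnion]; rintro ⟨A, hA, h⟩; exact hr A hA h

lemma IsMincutChain.weak {w : V → V → ℝ} (h0 : ∀ x y, 0 ≤ w x y) {r : V}
    {C : List (Finset V)} (h : IsMincutChain w r C) : WeakChain w r C :=
  weakChain_of (fun A hA => (h.2.2.2.2.1 A hA).mincut h0) h.2.2.2.1 h.2.2.2.2.2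

lemma core (r : V) (w : V → V → ℝ) (hsym : ∀ x y, w x y = w y x) (h0 : ∀ x y, 0 ≤ w x y)
    {A R Y Z : Finset V} (hA : IsMincut w A) (hR : IsMincut w R) (hAR : IsMincut w (A ∪ R))
    (hY : IsMincut w Y) (hZ : IsMincut w Z) (hZA : IsMincut w (Z ∪ A))
    (dAR : Disjoint A R) (dZA : Disjoint Z A) (dZR : Disjoint Z R) (dYA : Disjoint Y A)
    (dYR : Disjoint Y R) (hrZ : r ∉ Z) {u v : V} (hu : u ∈ A ∪ R) (hv : v ∈ Y)
    (huv : 0 < w u v) (hM : IsMincut w ((A ∪ R) ∪ Y)) (hrM : r ∉ (A ∪ R) ∪ Y)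
    (hmin : ∀ T : Finset V, IsMincut w T → u ∈ T → v ∈ T → r ∉ T →
      ((A ∪ R) ∪ Y).card ≤ T.card) : False := by
  have hrA : r ∉ A := fun h => hrM (by simp [h])
  have hrR : r ∉ R := fun h => hrM (by simp [h])
  have hrY : r ∉ Y := fun h => hrM (by simp [h])
  have dXY : Disjoint (A ∪ R) Y := (Finset.disjoint_union_right.2 ⟨dYA, dYR⟩).symm
  have eXY := mincut_half hsym hAR hY hM dXY
  have e1 := mincut_eq hA hAR
  have e2 := mincut_eq hA hR
  have e3 := mincut_eq hA hY
  have e4 := mincut_eq hA hZ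
  have eZA := mincut_half hsym hZ hA hZA dZA
  have eAR := mincut_half hsym hA hR hAR dAR
  have sXY := cutW_union_left' w Y dAR
  rw [cutW_comm' w hsym Z A] at eZA
  by_cases hN : (Y ∩ Z).Nonempty
  · have hNm := (mincut_inter_union h0 hY hZ hrY hrZ hN).1
    have hAN : ((A ∪ R) ∪ Y) ∩ (Z ∪ A) = A ∪ (Y ∩ Z) := by
      ext x
      have := fun hx => Finset.disjoint_left.1 dZR (show x ∈ _ from hx)
      simp only [mem_inter, mem_union]; tauto
    have hANm : IsMincut w (A ∪ (Y ∩ Z)) := by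
      rw [← hAN]
      refine (mincut_inter_union h0 hM hZA hrM (by simp [hrZ, hrA]) ?_).1
      rw [hAN]; exact hN.mono Finset.subset_union_right
    have dAN : Disjoint A (Y ∩ Z) := dYA.symm.mono_right Finset.inter_subset_left
    have eAN := mincut_half hsym hA hNm hANm dAN
    have hYs : Y = (Y ∩ Z) ∪ (Y \ Z) := by ext x; simp only [mem_union, mem_inter, mem_sdiff]; tauto
    have dYs : Disjoint (Y ∩ Z) (Y \ Z) := by
      rw [Finset.disjoint_left]; intro x; simp only [mem_inter, mem_sdiff]; tauto
    have sAY : cutW w A Y = cutW w A (Y ∩ Z) + cutW w A (Y \ Z) := by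
      rw [← cutW_union_right' w A dYs, ← hYs]
    have p1 := cutW_nonneg' w h0 A (Y \ Z)
    have p2 := cutW_nonneg' w h0 R Y
    have huR : u ∉ R := fun h => by
      have := cutW_pos' w h0 h hv huv
      linarith
    have huA : u ∈ A := by simp only [mem_union] at hu; tauto
    have hvZ : v ∈ Z := by
      by_contra h
      have := cutW_pos' w h0 huA (Finset.mem_sdiff.2 ⟨hv, h⟩) huv
      linarith
    have hle := hmin (A ∪ (Y ∩ Z)) hANm (by simp [huA]) (by simp [hv, hvZ]) (by simp [hrA, hrY])
    refine absurd hle (not_le.2 (Finset.card_lt_card ?_))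
    obtain ⟨x, hx⟩ := hR.1.1
    refine (Finset.ssubset_iff_of_subset ?_).2 ⟨x, by simp [hx], ?_⟩
    · intro y; simp only [mem_union, mem_inter]; tauto
    · have := Finset.disjoint_right.1 dAR hx
      have := Finset.disjoint_right.1 dYR hx
      simp only [mem_union, mem_inter]; tauto
  · have dYZ : Disjoint Y Z := by
      rw [Finset.disjoint_iff_inter_eq_empty]; exact Finset.not_nonempty_iff_eq_empty.1 hN
    have h3 := cutVal_two w h0 (A := A) (B := Z ∪ R) (D := Y)
      (Finset.disjoint_union_right.2 ⟨dZA.symm, dAR⟩) dYA.symm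
      (Finset.disjoint_union_left.2 ⟨dYZ.symm, dYR.symm⟩)
    rw [cutW_union_right' w A dZR] at h3
    have p1 := cutW_nonneg' w h0 A Y
    have huA : u ∉ A := fun h => by
      have := cutW_pos' w h0 h hv huv
      linarith
    have huR : u ∈ R := by simp only [mem_union] at hu; tauto
    have eRY := cutVal_union w hsym dYR.symm
    have hRY : IsMincut w (R ∪ Y) := mincut_of_le hA
      (isCut_of (r := r) (hR.1.1.mono Finset.subset_union_left) (by simp [hrR, hrY]))
      (by linarith)
    have hle := hmin (R ∪ Y) hRY (by simp [huR]) (by simp [hv]) (by simp [hrR, hrY])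
    refine absurd hle (not_le.2 (Finset.card_lt_card ?_))
    obtain ⟨x, hx⟩ := hA.1.1
    refine (Finset.ssubset_iff_of_subset ?_).2 ⟨x, by simp [hx], ?_⟩
    · intro y; simp only [mem_union]; tauto
    · have := Finset.disjoint_left.1 dAR hx
      have := Finset.disjoint_right.1 dYA hx
      simp only [mem_union]; tauto

lemma core2 (r : V) (w : V → V → ℝ) (hsym : ∀ x y, w x y = w y x) (h0 : ∀ x y, 0 ≤ w x y)
    {X Y Z : Finset V} {C' : List (Finset V)} (hl : 2 ≤ C'.length) (hD : WeakChain w r (Z :: C'))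
    (hX : chainUnion C' = X) (hY : IsMincut w Y) (dXY : Disjoint X Y)
    (hE : ∃ u₁ u₂, IsMinimalMincutOfEdge w r u₁ u₂ (X ∪ Y)) : False := by
  obtain ⟨u₁, u₂, hedge, hM, hu₁, hu₂, hrM, hmin⟩ := hE
  have hXm : IsMincut w X := hX ▸ WeakChain.union_mincut h0 (by rintro rfl; simp at hl)
    (hD.infix (List.suffix_cons Z _).isInfix)
  match C', hl with
  | A :: B :: L, _ =>
    have hC := hD.infix (List.suffix_cons Z _).isInfix
    have hR := (hC.infix (List.suffix_cons A _).isInfix).union_mincut h0 (by simp)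
    have hX' : X = A ∪ chainUnion (B :: L) := hX.symm
    have dAR : Disjoint A (chainUnion (B :: L)) := by
      rw [Finset.disjoint_left]; intro x hx; rw [mem_chainUnion]; rintro ⟨T, hT, hxT⟩
      exact Finset.disjoint_left.1 (List.rel_of_pairwise_cons hC.2.1 hT) hx hxT
    have dZT : ∀ T ∈ A :: B :: L, Disjoint Z T := fun T hT => List.rel_of_pairwise_cons hD.2.1 hT
    have dZR : Disjoint Z (chainUnion (B :: L)) := by
      rw [Finset.disjoint_left]; intro x hx; rw [mem_chainUnion]; rintro ⟨T, hT, hxT⟩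
      exact Finset.disjoint_left.1 (dZT T (List.mem_cons_of_mem _ hT)) hx hxT
    have hZ := hD.1 Z (by simp)
    have hA := hC.1 A (by simp)
    have hZA : IsMincut w (Z ∪ A) := (List.isChain_cons_cons.1 hD.2.2).1
    have key : ∀ u v, u ∈ X → v ∈ Y → 0 < w u v → (∀ T : Finset V, IsMincut w T → u ∈ T → v ∈ T →
        r ∉ T → (X ∪ Y).card ≤ T.card) → False := by
      subst hX'
      intro u v hu hv huv hm
      rw [Finset.disjoint_union_left] at dXY
      exact core r w hsym h0 hA.1 hR hXm hY hZ.1 hZA dAR (dZT A (by simp)) dZR dXY.1.symm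
        dXY.2.symm hZ.2 hu hv huv hM hrM hm
    have hrX : r ∉ X := fun h => hrM (by simp [h])
    have hrY : r ∉ Y := fun h => hrM (by simp [h])
    have cU := Finset.card_union_of_disjoint dXY
    have cX := hXm.1.1.card_pos
    have cY := hY.1.1.card_pos
    rcases Finset.mem_union.1 hu₁ with a | a <;> rcases Finset.mem_union.1 hu₂ with b | b
    · have := hmin X hXm a b hrX; omega
    · exact key u₁ u₂ a b hedge.2 hmin
    · exact key u₂ u₁ b a (hsym u₁ u₂ ▸ hedge.2) fun T h1 h2 h3 => hmin T h1 h3 h2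
    · have := hmin Y hY a b hrY; omega

end Helpers

/-- if a member `C_i` of a chain has a chain certificate `C'`, then `C'` is a
maximal chain. -/
theorem chain_member_certificate_maximal
    (r : V) (w : V → V → ℝ)
    (hcard : 1 < Fintype.card V)
    (hsym : ∀ x y, w x y = w y x)
    (hnonneg : ∀ x y, 0 ≤ w x y)
    (hdiag : ∀ x, w x x = 0)
    (C : List (Finset V)) (hC : IsMincutChain w r C)
    (i : ℕ) (hi : i < C.length)
    (C' : List (Finset V)) (hC' : IsMincutChain w r C')
    (hU : chainUnion C' = C.get ⟨i, hi⟩) :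
    IsMaximalMincutChain w r C' := by
  refine ⟨hC', ?_⟩
  have hCw := hC.weak hnonneg
  -- a neighbour of the member
  have hnb : ∃ Y, IsMincut w Y ∧ Disjoint (C.get ⟨i, hi⟩) Y ∧
      ∃ u₁ u₂, IsMinimalMincutOfEdge w r u₁ u₂ (C.get ⟨i, hi⟩ ∪ Y) := by
    have hdis := List.pairwise_iff_get.1 hCw.2.1
    by_cases h : i + 1 < C.length
    · refine ⟨C.get ⟨i + 1, h⟩, (hCw.1 _ (List.get_mem _ _)).1, hdis _ _ ?_, hC.2.2.2.2.2 i h⟩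
      simp
    · have hl := hC.1
      obtain ⟨j, rfl⟩ : ∃ j, i = j + 1 := ⟨i - 1, by omega⟩
      refine ⟨C.get ⟨j, by omega⟩, (hCw.1 _ (List.get_mem _ _)).1, (hdis _ _ ?_).symm, ?_⟩
      · simp
      · rw [Finset.union_comm]; exact hC.2.2.2.2.2 j hi
  obtain ⟨Y, hY, dXY, hE⟩ := hnb
  have main : ∀ D C'' : List (Finset V), WeakChain w r D → 2 ≤ C''.length →
      chainUnion C'' = C.get ⟨i, hi⟩ → ∀ s t, s ++ C'' ++ t = D → s ≠ [] → False := by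
    intro D C'' hD hl hX s t hst hs
    obtain ⟨s', Z, rfl⟩ := List.eq_nil_or_concat s |>.resolve_left hs
    refine core2 r w hsym hnonneg hl (hD.infix (D := Z :: C'') ⟨s', t, ?_⟩) hX hY dXY hE
    rw [← hst]; simp
  have hrevU : chainUnion C'.reverse = C.get ⟨i, hi⟩ := by
    rw [← hU]; ext x; simp [mem_chainUnion]
  have main2 : ∀ D : List (Finset V), WeakChain w r D → C'.length < D.length →
      C' <:+: D → False := by
    rintro D hD hlt ⟨s, t, hst⟩
    by_cases hs : s = []
    · refine main D.reverse C'.reverse hD.reverse (by simpa using hC'.1) hrevU t.reverse s.reverse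
        (by rw [← hst]; simp) ?_
      rintro ht
      have ht : t = [] := by simpa using ht
      subst hs ht; simp at hst; subst hst; omega
    · exact main D C' hD hC'.1 hU s t hst hs
  rintro ⟨D, hD, hlt, h | h⟩
  · exact main2 D (hD.weak hnonneg) hlt h
  · exact main2 D.reverse (hD.weak hnonneg).reverse (by simpa using hlt) h
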